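/- arXiv:1308.2501 — 8 statements merged into one kernel-verified Lean document; each statement's English description precedes it below -/
import Mathlib

section
/- Let η₁, …, η₅ be smooth vector fields on an open set U ⊆ ℝ⁵ satisfying [η₁,η₂] = η₃, [η₁,η₃] = η₄, [η₂,η₃] = η₅. Define the vector field Ab on U × ℝ⁵ by Ab(x,p) = H_{η₅}(x,p)·X_{η₁}(x,p) − H_{η₄}(x,p)·X_{η₂}(x,p). Then at every point (x,p) ∈ U × ℝ⁵ satisfying H_{η₁}(x,p) = H_{η₂}(x,p) = H_{η₃}(x,p) = 0, one has D H_{η₁}(x,p)(Ab(x,p)) = 0, D H_{η₂}(x,p)(Ab(x,p)) = 0 and D H_{η₃}(x,p)(Ab(x,p)) = 0; that is, Ab is tangent to the common zero locus of H_{η₁}, H_{η₂}, H_{η₃} (the annihilator of the square D² of the distribution D = ⟨η₁,η₂⟩). -/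
open scoped BigOperators

/-- Hamiltonian lift `H_ξ(x,p) = ⟨p, ξ(x)⟩` of a vector field `ξ` on `ℝⁿ`. -/
noncomputable def Hlift {n : ℕ} (ξ : (Fin n → ℝ) → (Fin n → ℝ))
    (q : (Fin n → ℝ) × (Fin n → ℝ)) : ℝ :=
  ∑ i, q.2 i * ξ q.1 i

/-- Hamiltonian vector field `X_ξ(x,p) = (ξ(x), −(Dξ(x))* p)` of `ξ`. -/
noncomputable def Hvf {n : ℕ} (ξ : (Fin n → ℝ) → (Fin n → ℝ))
    (q : (Fin n → ℝ) × (Fin n → ℝ)) : (Fin n → ℝ) × (Fin n → ℝ) :=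
  (ξ q.1, fun i => -∑ j, q.2 j * fderiv ℝ ξ q.1 (Pi.single i 1) j)

/-- Lie bracket `[ξ, η](x) = Dη(x)(ξ(x)) − Dξ(x)(η(x))` of vector fields on `ℝⁿ`. -/
noncomputable def lieBracketVF {n : ℕ} (ξ η : (Fin n → ℝ) → (Fin n → ℝ))
    (x : Fin n → ℝ) : Fin n → ℝ :=
  fderiv ℝ η x (ξ x) - fderiv ℝ ξ x (η x)

theorem hasFDerivAt_Hlift {n : ℕ} {η : (Fin n → ℝ) → (Fin n → ℝ)} {x : Fin n → ℝ}
    (hη : DifferentiableAt ℝ η x) (p : Fin n → ℝ) :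
    HasFDerivAt (Hlift η)
      (∑ i, (p i • ((ContinuousLinearMap.proj (R := ℝ) (φ := fun _ : Fin n => ℝ) i).comp
          ((fderiv ℝ η x).comp (ContinuousLinearMap.fst ℝ (Fin n → ℝ) (Fin n → ℝ)))) +
        η x i • ((ContinuousLinearMap.proj (R := ℝ) (φ := fun _ : Fin n => ℝ) i).comp
          (ContinuousLinearMap.snd ℝ (Fin n → ℝ) (Fin n → ℝ))))) (x, p) := by
  have hfst : HasFDerivAt (fun q : (Fin n → ℝ) × (Fin n → ℝ) => η q.1)
      ((fderiv ℝ η x).comp (ContinuousLinearMap.fst ℝ (Fin n → ℝ) (Fin n → ℝ))) (x, p) :=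
    HasFDerivAt.comp (x, p) (g := η) hη.hasFDerivAt hasFDerivAt_fst
  have hsnd : HasFDerivAt (fun q : (Fin n → ℝ) × (Fin n → ℝ) => q.2)
      (ContinuousLinearMap.snd ℝ (Fin n → ℝ) (Fin n → ℝ)) (x, p) := hasFDerivAt_snd
  exact HasFDerivAt.fun_sum fun i _ =>
    (hasFDerivAt_pi'.1 hsnd i).mul (hasFDerivAt_pi'.1 hfst i)

/-- The derivative of `H_η` along the Hamiltonian vector field of `ξ` is `H_{[ξ, η]}`. -/
theorem fderiv_Hlift_Hvf {n : ℕ} (ξ : (Fin n → ℝ) → (Fin n → ℝ))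
    {η : (Fin n → ℝ) → (Fin n → ℝ)} {x : Fin n → ℝ}
    (hη : DifferentiableAt ℝ η x) (p : Fin n → ℝ) :
    fderiv ℝ (Hlift η) (x, p) (Hvf ξ (x, p)) = Hlift (lieBracketVF ξ η) (x, p) := by
  have hξ : ∀ j, fderiv ℝ ξ x (η x) j = ∑ i, η x i * fderiv ℝ ξ x (Pi.single i 1) j := by
    intro j
    conv_lhs => rw [pi_eq_sum_univ' (η x)]
    simp [map_sum, Finset.sum_apply]
  rw [(hasFDerivAt_Hlift hη p).fderiv]
  simp only [Hlift, Hvf, lieBracketVF, sum_apply, add_apply,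
    smul_apply, ContinuousLinearMap.comp_apply, ContinuousLinearMap.coe_fst',
    ContinuousLinearMap.coe_snd', ContinuousLinearMap.proj_apply, smul_eq_mul, Pi.sub_apply, hξ,
    mul_sub, mul_neg, Finset.sum_add_distrib, Finset.sum_sub_distrib, Finset.sum_neg_distrib,
    Finset.mul_sum]
  rw [sub_eq_add_neg, Finset.sum_comm]
  simp only [mul_left_comm]

theorem lieBracketVF_self {n : ℕ} (ξ : (Fin n → ℝ) → (Fin n → ℝ)) (x : Fin n → ℝ) :
    lieBracketVF ξ ξ x = 0 :=
  sub_self _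

theorem lieBracketVF_swap {n : ℕ} (ξ η : (Fin n → ℝ) → (Fin n → ℝ)) (x : Fin n → ℝ) :
    lieBracketVF ξ η x = -lieBracketVF η ξ x :=
  (neg_sub _ _).symm

/-- for a (2,3,5)-frame `η₁,…,η₅` on an open set `U ⊆ ℝ⁵`, the vector field
`Ab = H_{η₅}·X_{η₁} − H_{η₄}·X_{η₂}` is tangent to the common zero locus of
`H_{η₁}, H_{η₂}, H_{η₃}` (the annihilator of `D²`). -/
theorem statement2 (U : Set (Fin 5 → ℝ)) (hU : IsOpen U)
    (η₁ η₂ η₃ η₄ η₅ : (Fin 5 → ℝ) → (Fin 5 → ℝ))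
    (h1 : ContDiffOn ℝ (⊤ : ℕ∞) η₁ U) (h2 : ContDiffOn ℝ (⊤ : ℕ∞) η₂ U)
    (h3 : ContDiffOn ℝ (⊤ : ℕ∞) η₃ U) (h4 : ContDiffOn ℝ (⊤ : ℕ∞) η₄ U)
    (h5 : ContDiffOn ℝ (⊤ : ℕ∞) η₅ U)
    (b12 : ∀ x ∈ U, lieBracketVF η₁ η₂ x = η₃ x)
    (b13 : ∀ x ∈ U, lieBracketVF η₁ η₃ x = η₄ x)
    (b23 : ∀ x ∈ U, lieBracketVF η₂ η₃ x = η₅ x)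
    (Ab : ((Fin 5 → ℝ) × (Fin 5 → ℝ)) → ((Fin 5 → ℝ) × (Fin 5 → ℝ)))
    (hAb : Ab = fun q => Hlift η₅ q • Hvf η₁ q - Hlift η₄ q • Hvf η₂ q)
    (x : Fin 5 → ℝ) (hx : x ∈ U) (p : Fin 5 → ℝ)
    (h01 : Hlift η₁ (x, p) = 0) (h02 : Hlift η₂ (x, p) = 0)
    (h03 : Hlift η₃ (x, p) = 0) :
    fderiv ℝ (Hlift η₁) (x, p) (Ab (x, p)) = 0 ∧
    fderiv ℝ (Hlift η₂) (x, p) (Ab (x, p)) = 0 ∧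
    fderiv ℝ (Hlift η₃) (x, p) (Ab (x, p)) = 0 := by
  have diff {η : (Fin 5 → ℝ) → (Fin 5 → ℝ)} (h : ContDiffOn ℝ (⊤ : ℕ∞) η U) :
      DifferentiableAt ℝ η x :=
    (h.contDiffAt (hU.mem_nhds hx)).differentiableAt (by simp)
  have d1 := diff h1
  have d2 := diff h2
  have d3 := diff h3
  simp only [Hlift] at h03
  subst hAb
  simp only [map_sub, map_smul, fderiv_Hlift_Hvf _ d1, fderiv_Hlift_Hvf _ d2,
    fderiv_Hlift_Hvf _ d3, smul_eq_mul]
  refine ⟨?_, ?_, ?_⟩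
  · simp [Hlift, lieBracketVF_self, lieBracketVF_swap η₂ η₁, b12 x hx, h03]
  · simp [Hlift, lieBracketVF_self, b12 x hx, h03]
  · simp only [Hlift, b13 x hx, b23 x hx]
    ring
end

section
/- Let η₁, …, η₅ be smooth vector fields on an open set U ⊆ ℝ⁵ satisfying [η₁,η₂] = η₃, [η₁,η₃] = η₄, [η₂,η₃] = η₅. On ℝ × U define the smooth vector fields ζ(s,y) = (1, 0) and X(s,y) = (0, η₁(y) + s·η₂(y)). Then the following Lie bracket identities hold on ℝ × U: [ζ, X](s,y) = (0, η₂(y)); [X, [ζ, X]](s,y) = (0, η₃(y)); [X, [X, [ζ, X]]](s,y) = (0, η₄(y) + s·η₅(y)); and [ζ, [X, [X, [ζ, X]]]](s,y) = (0, η₅(y)). Consequently, if in addition η₁(y), …, η₅(y) are linearly independent for every y ∈ U, then at every point (s,y) ∈ ℝ × U the six vectors ζ, X, [ζ,X], [X,[ζ,X]], [X,[X,[ζ,X]]], [ζ,[X,[X,[ζ,X]]]] form a basis of ℝ⁶ (the prolongation has small growth (2,3,4,5,6)). -/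
open scoped BigOperators

/-- Lie bracket `[ξ, η](a) = Dη(a)(ξ(a)) − Dξ(a)(η(a))` of vector fields on a real
normed space. -/
noncomputable def vbkt {E : Type*} [NormedAddCommGroup E] [NormedSpace ℝ E]
    (ξ η : E → E) (a : E) : E :=
  fderiv ℝ η a (ξ a) - fderiv ℝ ξ a (η a)

section Prolongation

open Filter Topology

variable {E F : Type*} [NormedAddCommGroup E] [NormedSpace ℝ E]
  [NormedAddCommGroup F] [NormedSpace ℝ F]

theorem vbkt_congr_right {η η' : E → E} (ξ : E → E) {a : E} (h : η =ᶠ[𝓝 a] η') :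
    vbkt ξ η a = vbkt ξ η' a := by
  simp only [vbkt, h.fderiv_eq, h.eq_of_nhds]

/-- The vertical vector field `(s, y) ↦ (0, f y + s • g y)` on `ℝ × F`. -/
def affineField (f g : F → F) (q : ℝ × F) : ℝ × F := (0, f q.2 + q.1 • g q.2)

theorem fderiv_affineField {f g : F → F} {y : F} (hf : DifferentiableAt ℝ f y)
    (hg : DifferentiableAt ℝ g y) (s : ℝ) (v : ℝ × F) :
    fderiv ℝ (affineField f g) (s, y) v =
      (0, fderiv ℝ f y v.2 + s • fderiv ℝ g y v.2 + v.1 • g y) := by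
  have hf' : HasFDerivAt (fun q : ℝ × F => f q.2) _ (s, y) :=
    hf.hasFDerivAt.comp (s, y) hasFDerivAt_snd
  have hg' : HasFDerivAt (fun q : ℝ × F => g q.2) _ (s, y) :=
    hg.hasFDerivAt.comp (s, y) hasFDerivAt_snd
  have hs : HasFDerivAt (fun q : ℝ × F => q.1) (ContinuousLinearMap.fst ℝ ℝ F) (s, y) :=
    hasFDerivAt_fst
  have h : HasFDerivAt (affineField f g) _ (s, y) :=
    (hasFDerivAt_const (0 : ℝ) (s, y)).prodMk (hf'.add (hs.smul hg'))
  rw [h.fderiv]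
  simp [add_assoc]

theorem vbkt_const_affineField {f g : F → F} {y : F} (hf : DifferentiableAt ℝ f y)
    (hg : DifferentiableAt ℝ g y) (s : ℝ) :
    vbkt (fun _ => ((1 : ℝ), (0 : F))) (affineField f g) (s, y) = (0, g y) := by
  simp [vbkt, fderiv_affineField hf hg]

theorem vbkt_affineField {f g h : F → F} {y : F} (hf : DifferentiableAt ℝ f y)
    (hg : DifferentiableAt ℝ g y) (hh : DifferentiableAt ℝ h y) (s : ℝ) :
    vbkt (affineField f g) (affineField h 0) (s, y) = (0, vbkt f h y + s • vbkt g h y) := by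
  have h0 : DifferentiableAt ℝ (0 : F → F) y := differentiableAt_const 0
  rw [vbkt, fderiv_affineField hf hg, fderiv_affineField hh h0]
  ext
  · simp
  · simp [affineField, vbkt, smul_sub]
    abel

/-- The six vectors generated by the prolongation are independent when the frame is. -/
theorem linearIndependent_prolongation {v₁ v₂ v₃ v₄ v₅ : F}
    (h : LinearIndependent ℝ ![v₁, v₂, v₃, v₄, v₅]) (s : ℝ) :
    LinearIndependent ℝ ![((1 : ℝ), (0 : F)), (0, v₁ + s • v₂), (0, v₂), (0, v₃),
      (0, v₄ + s • v₅), (0, v₅)] := by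
  rw [Fintype.linearIndependent_iff] at h ⊢
  intro c hc
  simp only [Fin.sum_univ_six, Matrix.cons_val, Prod.smul_mk, Prod.mk_add_mk, Prod.mk_eq_zero,
    smul_eq_mul, mul_one, mul_zero, add_zero, smul_zero, zero_add] at hc
  obtain ⟨h0, hc⟩ := hc
  have key := h ![c 1, c 1 * s + c 2, c 3, c 4, c 4 * s + c 5] (by
    simp only [Fin.sum_univ_five, Matrix.cons_val]
    rw [← hc]
    module)
  have k0 := key 0
  have k1 := key 1
  have k2 := key 2
  have k3 := key 3
  have k4 := key 4
  simp only [Matrix.cons_val] at k0 k1 k2 k3 k4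
  simp only [k0, k3, zero_mul, zero_add] at k1 k4
  intro i
  fin_cases i <;> assumption

end Prolongation

/-- for a (2,3,5)-frame `η₁,…,η₅` on an open set `U ⊆ ℝ⁵`, the prolonged
vector fields `ζ(s,y) = (1,0)` and `X(s,y) = (0, η₁(y) + s·η₂(y))` on `ℝ × U` satisfy
`[ζ,X] = (0,η₂)`, `[X,[ζ,X]] = (0,η₃)`, `[X,[X,[ζ,X]]] = (0, η₄ + s·η₅)`,
`[ζ,[X,[X,[ζ,X]]]] = (0,η₅)`; hence if `η₁(y),…,η₅(y)` are linearly independent for all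
`y ∈ U`, the six vectors `ζ, X, [ζ,X], [X,[ζ,X]], [X,[X,[ζ,X]]], [ζ,[X,[X,[ζ,X]]]]`
form a basis of `ℝ⁶ = ℝ × ℝ⁵` at every point of `ℝ × U`. -/
theorem statement4 (U : Set (Fin 5 → ℝ)) (hU : IsOpen U)
    (η₁ η₂ η₃ η₄ η₅ : (Fin 5 → ℝ) → (Fin 5 → ℝ))
    (h1 : ContDiffOn ℝ (⊤ : ℕ∞) η₁ U) (h2 : ContDiffOn ℝ (⊤ : ℕ∞) η₂ U)
    (h3 : ContDiffOn ℝ (⊤ : ℕ∞) η₃ U) (h4 : ContDiffOn ℝ (⊤ : ℕ∞) η₄ U)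
    (h5 : ContDiffOn ℝ (⊤ : ℕ∞) η₅ U)
    (b12 : ∀ y ∈ U, vbkt η₁ η₂ y = η₃ y)
    (b13 : ∀ y ∈ U, vbkt η₁ η₃ y = η₄ y)
    (b23 : ∀ y ∈ U, vbkt η₂ η₃ y = η₅ y)
    (ζ X : (ℝ × (Fin 5 → ℝ)) → (ℝ × (Fin 5 → ℝ)))
    (hζ : ζ = fun _ => ((1 : ℝ), (0 : Fin 5 → ℝ)))
    (hX : X = fun q => ((0 : ℝ), η₁ q.2 + q.1 • η₂ q.2)) :
    (∀ (s : ℝ), ∀ y ∈ U,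
      vbkt ζ X (s, y) = (0, η₂ y) ∧
      vbkt X (vbkt ζ X) (s, y) = (0, η₃ y) ∧
      vbkt X (vbkt X (vbkt ζ X)) (s, y) = (0, η₄ y + s • η₅ y) ∧
      vbkt ζ (vbkt X (vbkt X (vbkt ζ X))) (s, y) = (0, η₅ y)) ∧
    ((∀ y ∈ U, LinearIndependent ℝ ![η₁ y, η₂ y, η₃ y, η₄ y, η₅ y]) →
      ∀ (s : ℝ), ∀ y ∈ U,
        LinearIndependent ℝ
          ![ζ (s, y), X (s, y), vbkt ζ X (s, y), vbkt X (vbkt ζ X) (s, y),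
            vbkt X (vbkt X (vbkt ζ X)) (s, y),
            vbkt ζ (vbkt X (vbkt X (vbkt ζ X))) (s, y)] ∧
        Submodule.span ℝ
          (Set.range
            ![ζ (s, y), X (s, y), vbkt ζ X (s, y), vbkt X (vbkt ζ X) (s, y),
              vbkt X (vbkt X (vbkt ζ X)) (s, y),
              vbkt ζ (vbkt X (vbkt X (vbkt ζ X))) (s, y)]) = ⊤) := by
  have d1 : ∀ y ∈ U, DifferentiableAt ℝ η₁ y := fun y hy =>
    (h1.contDiffAt (hU.mem_nhds hy)).differentiableAt (by simp)
  have d2 : ∀ y ∈ U, DifferentiableAt ℝ η₂ y := fun y hy =>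
    (h2.contDiffAt (hU.mem_nhds hy)).differentiableAt (by simp)
  have d3 : ∀ y ∈ U, DifferentiableAt ℝ η₃ y := fun y hy =>
    (h3.contDiffAt (hU.mem_nhds hy)).differentiableAt (by simp)
  have d4 : ∀ y ∈ U, DifferentiableAt ℝ η₄ y := fun y hy =>
    (h4.contDiffAt (hU.mem_nhds hy)).differentiableAt (by simp)
  have d5 : ∀ y ∈ U, DifferentiableAt ℝ η₅ y := fun y hy =>
    (h5.contDiffAt (hU.mem_nhds hy)).differentiableAt (by simp)
  have eventually_of_eqOn : ∀ {Y Z : ℝ × (Fin 5 → ℝ) → ℝ × (Fin 5 → ℝ)},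
      (∀ s, ∀ y ∈ U, Y (s, y) = Z (s, y)) → ∀ (s : ℝ), ∀ y ∈ U, Y =ᶠ[nhds (s, y)] Z := by
    intro Y Z hYZ s y hy
    filter_upwards [(hU.preimage continuous_snd).mem_nhds (show (s, y).2 ∈ U from hy)] with q hq
    exact hYZ q.1 q.2 hq
  replace hX : X = affineField η₁ η₂ := hX
  have e1 : ∀ s, ∀ y ∈ U, vbkt ζ X (s, y) = (0, η₂ y) := fun s y hy => by
    rw [hζ, hX, vbkt_const_affineField (d1 y hy) (d2 y hy)]
  have e2 : ∀ s, ∀ y ∈ U, vbkt X (vbkt ζ X) (s, y) = (0, η₃ y) := fun s y hy => by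
    rw [vbkt_congr_right X (eventually_of_eqOn (Z := affineField η₂ 0)
      (fun s y hy => by simp [e1 s y hy, affineField]) s y hy), hX,
      vbkt_affineField (d1 y hy) (d2 y hy) (d2 y hy), b12 y hy]
    simp [vbkt]
  have e3 : ∀ s, ∀ y ∈ U,
      vbkt X (vbkt X (vbkt ζ X)) (s, y) = (0, η₄ y + s • η₅ y) := fun s y hy => by
    rw [vbkt_congr_right X (eventually_of_eqOn (Z := affineField η₃ 0)
      (fun s y hy => by simp [e2 s y hy, affineField]) s y hy), hX,
      vbkt_affineField (d1 y hy) (d2 y hy) (d3 y hy), b13 y hy, b23 y hy]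
  have e4 : ∀ s, ∀ y ∈ U,
      vbkt ζ (vbkt X (vbkt X (vbkt ζ X))) (s, y) = (0, η₅ y) := fun s y hy => by
    rw [vbkt_congr_right ζ (eventually_of_eqOn (Z := affineField η₄ η₅) e3 s y hy), hζ,
      vbkt_const_affineField (d4 y hy) (d5 y hy)]
  refine ⟨fun s y hy => ⟨e1 s y hy, e2 s y hy, e3 s y hy, e4 s y hy⟩, fun hli s y hy => ?_⟩
  rw [e1 s y hy, e2 s y hy, e3 s y hy, e4 s y hy, hζ, hX]
  have hind := linearIndependent_prolongation (hli y hy) s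
  exact ⟨hind, hind.span_eq_top_of_card_eq_finrank (by simp)⟩
end

section
/- Let ξ : ℝⁿ × ℝᵏ → ℝⁿ be a smooth map, and define Φ : ℝⁿ × ℝᵏ × ℝ → ℝⁿ × ℝⁿ by Φ(x, w, λ) = (x, λ·ξ(x,w)). Then Φ is an immersion at a point (x, w, λ) (i.e. the Fréchet derivative DΦ(x,w,λ) is injective) if and only if the k+1 vectors ξ(x,w), λ·(∂ξ/∂w₁)(x,w), …, λ·(∂ξ/∂wₖ)(x,w) are linearly independent in ℝⁿ. -/
open scoped BigOperators

/-- The derivative of `(x, w, l) ↦ (x, l • ξ (x, w))`, evaluated at a vector. -/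
theorem fderiv_prodMk_smul_apply {E F G : Type*} [NormedAddCommGroup E] [NormedSpace ℝ E]
    [NormedAddCommGroup F] [NormedSpace ℝ F] [NormedAddCommGroup G] [NormedSpace ℝ G]
    {ξ : E × F → G} {x : E} {w : F} (hξ : DifferentiableAt ℝ ξ (x, w)) (l : ℝ) (v : E × F × ℝ) :
    fderiv ℝ (fun q : E × F × ℝ => (q.1, q.2.2 • ξ (q.1, q.2.1))) (x, w, l) v =
      (v.1, l • fderiv ℝ ξ (x, w) (v.1, v.2.1) + v.2.2 • ξ (x, w)) := by
  have hfst : HasFDerivAt (fun q : E × F × ℝ => q.1)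
      (ContinuousLinearMap.fst ℝ E (F × ℝ)) (x, w, l) := hasFDerivAt_fst
  have hsnd : HasFDerivAt (fun q : E × F × ℝ => q.2)
      (ContinuousLinearMap.snd ℝ E (F × ℝ)) (x, w, l) := hasFDerivAt_snd
  have hξ' : HasFDerivAt (fun q : E × F × ℝ => ξ (q.1, q.2.1)) _ (x, w, l) :=
    HasFDerivAt.comp (g := ξ) (x, w, l) hξ.hasFDerivAt (hfst.prodMk hsnd.fst)
  have h : HasFDerivAt (fun q : E × F × ℝ => (q.1, q.2.2 • ξ (q.1, q.2.1))) _ (x, w, l) :=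
    hfst.prodMk (hsnd.snd.smul hξ')
  rw [h.fderiv]
  simp

/-- The partial derivative in the second variable is the restriction of the full derivative. -/
theorem fderiv_comp_prodMk_right_apply {E F G : Type*} [NormedAddCommGroup E] [NormedSpace ℝ E]
    [NormedAddCommGroup F] [NormedSpace ℝ F] [NormedAddCommGroup G] [NormedSpace ℝ G]
    {ξ : E × F → G} {x : E} {w : F} (hξ : DifferentiableAt ℝ ξ (x, w)) (v : F) :
    fderiv ℝ (fun w' => ξ (x, w')) w v = fderiv ℝ ξ (x, w) (0, v) := by
  have h : HasFDerivAt (fun w' => ξ (x, w')) _ w :=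
    HasFDerivAt.comp (g := ξ) w hξ.hasFDerivAt (hasFDerivAt_prodMk_right x w)
  rw [h.fderiv]
  simp

/-- A linear combination of a vector `u` and the scaled images of the standard basis under `A`. -/
theorem sum_smul_vecCons_apply_single {k : ℕ} {G : Type*} [AddCommGroup G] [Module ℝ G]
    (A : (Fin k → ℝ) →ₗ[ℝ] G) (u : G) (l : ℝ) (g : Fin (k + 1) → ℝ) :
    ∑ i, g i • Matrix.vecCons u (fun j => l • A (Pi.single j 1)) i =
      l • A (Fin.tail g) + g 0 • u := by
  rw [Fin.sum_univ_succ, LinearMap.pi_apply_eq_sum_univ A (Fin.tail g), Finset.smul_sum, add_comm]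
  simp [Fin.tail, smul_comm l, ← Pi.single_apply, Pi.single_comm]

/-- for a smooth family `ξ : ℝⁿ × ℝᵏ → ℝⁿ`, the map
`Φ(x,w,λ) = (x, λ·ξ(x,w))` is an immersion at `(x,w,λ)` if and only if the `k+1`
vectors `ξ(x,w), λ·∂ξ/∂w₁(x,w), …, λ·∂ξ/∂wₖ(x,w)` are linearly independent. -/
theorem statement5 {n k : ℕ} (ξ : ((Fin n → ℝ) × (Fin k → ℝ)) → (Fin n → ℝ))
    (hξ : ContDiff ℝ (⊤ : ℕ∞) ξ)
    (Φ : ((Fin n → ℝ) × (Fin k → ℝ) × ℝ) → ((Fin n → ℝ) × (Fin n → ℝ)))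
    (hΦ : Φ = fun q => (q.1, q.2.2 • ξ (q.1, q.2.1)))
    (x : Fin n → ℝ) (w : Fin k → ℝ) (lam : ℝ) :
    Function.Injective ⇑(fderiv ℝ Φ (x, w, lam)) ↔
      LinearIndependent ℝ
        (Matrix.vecCons (ξ (x, w))
          (fun j : Fin k => lam • fderiv ℝ (fun w' => ξ (x, w')) w (Pi.single j 1))) := by
  have hd : DifferentiableAt ℝ ξ (x, w) := hξ.differentiable (by simp) _
  rw [hΦ, injective_iff_map_eq_zero, Fintype.linearIndependent_iff]
  have hsum := sum_smul_vecCons_apply_single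
    (fderiv ℝ (fun w' => ξ (x, w')) w).toLinearMap (ξ (x, w)) lam
  simp only [ContinuousLinearMap.coe_coe, fderiv_comp_prodMk_right_apply hd] at hsum
  simp only [fderiv_prodMk_smul_apply hd, fderiv_comp_prodMk_right_apply hd, hsum]
  constructor
  · intro h g hg i
    have h0 := h (0, Fin.tail g, g 0) (by simpa using hg)
    simp only [Prod.mk_eq_zero, true_and] at h0
    exact Fin.cases h0.2 (congrFun h0.1) i
  · rintro h ⟨a, b, c⟩ hv
    obtain ⟨rfl, hv⟩ := Prod.mk_eq_zero.mp hv
    have h0 := h (Fin.cons c b) (by simpa using hv)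
    have hb : b = 0 := funext fun j => by simpa using h0 j.succ
    have hc : c = 0 := by simpa using h0 0
    simp [hb, hc]
end

section
/- With ξ₁, ξ₂ the G₂-Engel vector fields on ℝ⁶: at every point p ∈ ℝ⁶, the six vectors ξ₁(p), ξ₂(p), [ξ₁,ξ₂](p), [ξ₁,[ξ₁,ξ₂]](p), [ξ₁,[ξ₁,[ξ₁,ξ₂]]](p), and [ξ₂,[ξ₁,[ξ₁,[ξ₁,ξ₂]]]](p) form a basis of ℝ⁶; in particular the distribution E = ⟨ξ₁, ξ₂⟩ is bracket generating with small growth (2,3,4,5,6). -/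
open scoped BigOperators

/-- The G₂ fibration `π_Y(λ,x,y,z,u,v) = (λ, x+λy, y+λz, v+λx, u+λ(y²−xz))`,
with coordinates `(λ,x,y,z,u,v) = (p 0, …, p 5)` on `ℝ⁶`. -/
noncomputable def piY (p : Fin 6 → ℝ) : Fin 5 → ℝ :=
  ![p 0, p 1 + p 0 * p 2, p 2 + p 0 * p 3, p 5 + p 0 * p 1,
    p 4 + p 0 * ((p 2) ^ 2 - p 1 * p 3)]

/-- The G₂ fibration `π_X(λ,x,y,z,u,v) = (x,y,z,u,v)`. -/
noncomputable def piX (p : Fin 6 → ℝ) : Fin 5 → ℝ :=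
  ![p 1, p 2, p 3, p 4, p 5]

/-- The G₂-Engel vector field `ξ₁ = ∂/∂λ`. -/
noncomputable def xi1 (_p : Fin 6 → ℝ) : Fin 6 → ℝ :=
  ![1, 0, 0, 0, 0, 0]

/-- The G₂-Engel vector field
`ξ₂ = ∂/∂z − λ∂/∂y + λ²∂/∂x − λ³∂/∂v + (λ³z + 2λ²y + λx)∂/∂u`. -/
noncomputable def xi2 (p : Fin 6 → ℝ) : Fin 6 → ℝ :=
  ![0, (p 0) ^ 2, -(p 0), 1, (p 0) ^ 3 * p 3 + 2 * (p 0) ^ 2 * p 2 + p 0 * p 1,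
    -(p 0) ^ 3]

/-- The directional derivative of a vector field on `ℝⁿ`, componentwise, from derivatives
along the line through the point. -/
theorem fderiv_apply_eq_of_hasDerivAt_line {n : ℕ} {f : (Fin n → ℝ) → Fin n → ℝ}
    {a w c : Fin n → ℝ} (hf : DifferentiableAt ℝ f a)
    (h : ∀ i, HasDerivAt (fun t : ℝ => f (a + t • w) i) (c i) 0) :
    fderiv ℝ f a w = c := by
  rw [← hf.lineDeriv_eq_fderiv]
  exact HasLineDerivAt.lineDeriv (hasDerivAt_pi.2 h)

theorem differentiable_xi2 : Differentiable ℝ xi2 := by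
  refine differentiable_pi.2 fun i => ?_
  fin_cases i <;> simp [xi2] <;> fun_prop

theorem vbkt_xi1 (η : (Fin 6 → ℝ) → Fin 6 → ℝ) (a : Fin 6 → ℝ) :
    vbkt xi1 η a = fderiv ℝ η a ![1, 0, 0, 0, 0, 0] := by
  have h : fderiv ℝ xi1 a = 0 := fderiv_const_apply (![1, 0, 0, 0, 0, 0] : Fin 6 → ℝ)
  simp [vbkt, h, xi1]

theorem vbkt_xi1_xi2 :
    vbkt xi1 xi2 = fun p => ![0, 2 * p 0, -1, 0,
      3 * p 0 ^ 2 * p 3 + 4 * p 0 * p 2 + p 1, -(3 * p 0 ^ 2)] := by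
  funext p
  rw [vbkt_xi1]
  refine fderiv_apply_eq_of_hasDerivAt_line (differentiable_xi2 p) fun i => ?_
  have h := (hasDerivAt_id' (0 : ℝ)).const_add (p 0)
  fin_cases i <;> simp [xi2, hasDerivAt_const]
  · exact (h.fun_pow 2).congr_deriv (by simp)
  · exact hasDerivAt_neg' _
  · exact ((((h.fun_pow 3).mul_const (p 3)).add (((h.fun_pow 2).const_mul 2).mul_const (p 2))).add
      (h.mul_const (p 1))).congr_deriv (by push_cast; ring)
  · exact (h.fun_pow 3).fun_neg.congr_deriv (by simp)

theorem vbkt_xi1_vbkt_xi1_xi2 :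
    vbkt xi1 (vbkt xi1 xi2) = fun p => ![0, 2, 0, 0, 6 * p 0 * p 3 + 4 * p 2, -(6 * p 0)] := by
  funext p
  rw [vbkt_xi1, vbkt_xi1_xi2]
  refine fderiv_apply_eq_of_hasDerivAt_line (differentiableAt_pi.2 fun i => ?_) fun i => ?_
  · fin_cases i <;> simp <;> fun_prop
  have h := (hasDerivAt_id' (0 : ℝ)).const_add (p 0)
  fin_cases i <;> simp [hasDerivAt_const]
  · exact (h.const_mul 2).congr_deriv (by simp)
  · exact ((((h.fun_pow 2).const_mul 3).mul_const (p 3)).add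
      ((h.const_mul 4).mul_const (p 2))).congr_deriv (by push_cast; ring)
  · exact ((h.fun_pow 2).const_mul 3).fun_neg.congr_deriv (by push_cast; ring)

theorem vbkt_xi1_vbkt_xi1_vbkt_xi1_xi2 :
    vbkt xi1 (vbkt xi1 (vbkt xi1 xi2)) = fun p => ![0, 0, 0, 0, 6 * p 3, -6] := by
  funext p
  rw [vbkt_xi1, vbkt_xi1_vbkt_xi1_xi2]
  refine fderiv_apply_eq_of_hasDerivAt_line (differentiableAt_pi.2 fun i => ?_) fun i => ?_
  · fin_cases i <;> simp <;> fun_prop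
  have h := (hasDerivAt_id' (0 : ℝ)).const_add (p 0)
  fin_cases i <;> simp [hasDerivAt_const]
  · exact ((h.const_mul 6).mul_const (p 3)).congr_deriv (by simp)
  · exact (h.const_mul 6).fun_neg.congr_deriv (by simp)

theorem vbkt_xi2_vbkt_xi1_vbkt_xi1_vbkt_xi1_xi2 (p : Fin 6 → ℝ) :
    vbkt xi2 (vbkt xi1 (vbkt xi1 (vbkt xi1 xi2))) p = ![0, 0, 0, 0, 6, 0] := by
  rw [vbkt_xi1_vbkt_xi1_vbkt_xi1_xi2, vbkt]
  have h₂ : fderiv ℝ xi2 p ![0, 0, 0, 0, 6 * p 3, -6] = 0 := by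
    refine fderiv_apply_eq_of_hasDerivAt_line (differentiable_xi2 p) fun i => ?_
    fin_cases i <;> simp [xi2, hasDerivAt_const]
  rw [h₂, sub_zero]
  refine fderiv_apply_eq_of_hasDerivAt_line (differentiableAt_pi.2 fun i => ?_) fun i => ?_
  · fin_cases i <;> simp
    fun_prop
  have h := (hasDerivAt_id' (0 : ℝ)).const_add (p 3)
  fin_cases i <;> simp [xi2, hasDerivAt_const]
  exact (h.const_mul 6).congr_deriv (by simp)

/-- at every `p ∈ ℝ⁶` the six vectors `ξ₁(p), ξ₂(p), [ξ₁,ξ₂](p),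
[ξ₁,[ξ₁,ξ₂]](p), [ξ₁,[ξ₁,[ξ₁,ξ₂]]](p), [ξ₂,[ξ₁,[ξ₁,[ξ₁,ξ₂]]]](p)` form a basis of
`ℝ⁶`; in particular `E = ⟨ξ₁, ξ₂⟩` is bracket generating with small growth
`(2,3,4,5,6)`. -/
theorem statement8 (p : Fin 6 → ℝ) :
    LinearIndependent ℝ
      ![xi1 p, xi2 p, vbkt xi1 xi2 p, vbkt xi1 (vbkt xi1 xi2) p,
        vbkt xi1 (vbkt xi1 (vbkt xi1 xi2)) p,
        vbkt xi2 (vbkt xi1 (vbkt xi1 (vbkt xi1 xi2))) p] ∧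
    Submodule.span ℝ
      (Set.range
        ![xi1 p, xi2 p, vbkt xi1 xi2 p, vbkt xi1 (vbkt xi1 xi2) p,
          vbkt xi1 (vbkt xi1 (vbkt xi1 xi2)) p,
          vbkt xi2 (vbkt xi1 (vbkt xi1 (vbkt xi1 xi2))) p]) = ⊤ := by
  refine (and_iff_left_of_imp fun h => h.span_eq_top_of_card_eq_finrank (by simp)).2 ?_
  rw [vbkt_xi2_vbkt_xi1_vbkt_xi1_vbkt_xi1_xi2, vbkt_xi1_vbkt_xi1_vbkt_xi1_xi2,
    vbkt_xi1_vbkt_xi1_xi2, vbkt_xi1_xi2]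
  rw [Fintype.linearIndependent_iff]
  intro g hg
  have h0 := congrFun hg 0
  have h1 := congrFun hg 1
  have h2 := congrFun hg 2
  have h3 := congrFun hg 3
  have h4 := congrFun hg 4
  have h5 := congrFun hg 5
  simp [Fin.sum_univ_succ, xi1, xi2] at h0 h1 h2 h3 h4 h5
  have g2 : g 2 = 0 := by simpa [h3] using h2
  have g3 : g 3 = 0 := by simpa [h3, g2] using h1
  have g4 : g 4 = 0 := by simpa [h3, g2, g3] using h5
  have g5 : g 5 = 0 := by simpa [h3, g2, g3, g4] using h4
  intro i
  fin_cases i <;> assumption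
end

section
/- With η₁, η₂ the G₂-Cartan vector fields on ℝ⁵: at every point a ∈ ℝ⁵, the five vectors η₁(a), η₂(a), [η₁,η₂](a), [η₁,[η₁,η₂]](a), and [η₂,[η₁,η₂]](a) form a basis of ℝ⁵; in particular the rank-two distribution D = ⟨η₁, η₂⟩ has growth (2,3,5) at every point. -/
open scoped BigOperators

/-- The G₂-Cartan vector field `η₁ = ∂/∂λ + ν∂/∂μ − (λν−μ)∂/∂τ + ν²∂/∂σ`,
with coordinates `(λ,μ,ν,τ,σ) = (a 0, …, a 4)` on `ℝ⁵`. -/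
noncomputable def eta1 (a : Fin 5 → ℝ) : Fin 5 → ℝ :=
  ![1, a 2, 0, -(a 0 * a 2 - a 1), (a 2) ^ 2]

/-- The G₂-Cartan vector field `η₂ = ∂/∂ν − λ∂/∂μ + λ²∂/∂τ − (λν+μ)∂/∂σ`. -/
noncomputable def eta2 (a : Fin 5 → ℝ) : Fin 5 → ℝ :=
  ![0, -(a 0), 1, (a 0) ^ 2, -(a 0 * a 2 + a 1)]

/-- The coordinate functional `v ↦ v i` on `ℝ⁵`. -/
local notation "dx" => ContinuousLinearMap.proj (R := ℝ) (φ := fun _ : Fin 5 => ℝ)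

theorem fderiv_eta1_apply (a v : Fin 5 → ℝ) :
    fderiv ℝ eta1 a v = ![0, v 2, 0, -(v 0 * a 2 + a 0 * v 2 - v 1), 2 * a 2 * v 2] := by
  have hd (i : Fin 5) : HasFDerivAt (fun x : Fin 5 → ℝ => x i) (dx i) a := hasFDerivAt_apply i a
  have h : HasFDerivAt eta1 (ContinuousLinearMap.pi
      ![0, dx 2, 0, -((a 0 • dx 2 + a 2 • dx 0) - dx 1), (2 * a 2) • dx 2]) a := by
    rw [hasFDerivAt_pi']
    intro i
    fin_cases i
    · exact hasFDerivAt_const _ _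
    · exact hd 2
    · exact hasFDerivAt_const _ _
    · exact (((hd 0).mul (hd 2)).sub (hd 1)).neg
    · refine ((hd 2).pow 2).congr_fderiv ?_
      ext w
      simp
  rw [h.fderiv]
  ext i
  fin_cases i <;> simp
  ring

theorem fderiv_eta2_apply (a v : Fin 5 → ℝ) :
    fderiv ℝ eta2 a v = ![0, -v 0, 0, 2 * a 0 * v 0, -(v 0 * a 2 + a 0 * v 2 + v 1)] := by
  have hd (i : Fin 5) : HasFDerivAt (fun x : Fin 5 → ℝ => x i) (dx i) a := hasFDerivAt_apply i a
  have h : HasFDerivAt eta2 (ContinuousLinearMap.pi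
      ![0, -dx 0, 0, (2 * a 0) • dx 0, -((a 0 • dx 2 + a 2 • dx 0) + dx 1)]) a := by
    rw [hasFDerivAt_pi']
    intro i
    fin_cases i
    · exact hasFDerivAt_const _ _
    · exact (hd 0).neg
    · exact hasFDerivAt_const _ _
    · refine ((hd 0).pow 2).congr_fderiv ?_
      ext w
      simp
    · exact (((hd 0).mul (hd 2)).add (hd 1)).neg
  rw [h.fderiv]
  ext i
  fin_cases i <;> simp
  ring

theorem vbkt_eta1_eta2 :
    vbkt eta1 eta2 = fun a : Fin 5 → ℝ => ![0, -2, 0, 4 * a 0, -4 * a 2] := by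
  ext a i
  rw [vbkt, fderiv_eta1_apply, fderiv_eta2_apply]
  fin_cases i <;> simp [eta1, eta2] <;> ring

theorem fderiv_vbkt_eta1_eta2_apply (a v : Fin 5 → ℝ) :
    fderiv ℝ (vbkt eta1 eta2) a v = ![0, 0, 0, 4 * v 0, -4 * v 2] := by
  have hd (i : Fin 5) : HasFDerivAt (fun x : Fin 5 → ℝ => x i) (dx i) a := hasFDerivAt_apply i a
  have h : HasFDerivAt (vbkt eta1 eta2) (ContinuousLinearMap.pi
      ![0, 0, 0, (4 : ℝ) • dx 0, (-4 : ℝ) • dx 2]) a := by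
    rw [vbkt_eta1_eta2, hasFDerivAt_pi']
    intro i
    fin_cases i
    · exact hasFDerivAt_const _ _
    · exact hasFDerivAt_const _ _
    · exact hasFDerivAt_const _ _
    · exact (hd 0).const_mul 4
    · exact (hd 2).const_mul (-4)
  rw [h.fderiv]
  ext i
  fin_cases i <;> simp

theorem vbkt_eta1_vbkt_eta1_eta2 (a : Fin 5 → ℝ) :
    vbkt eta1 (vbkt eta1 eta2) a = ![0, 0, 0, 6, 0] := by
  rw [vbkt, fderiv_eta1_apply, fderiv_vbkt_eta1_eta2_apply, vbkt_eta1_eta2]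
  ext i
  fin_cases i <;> simp [eta1]
  norm_num

theorem vbkt_eta2_vbkt_eta1_eta2 (a : Fin 5 → ℝ) :
    vbkt eta2 (vbkt eta1 eta2) a = ![0, 0, 0, 0, -6] := by
  rw [vbkt, fderiv_eta2_apply, fderiv_vbkt_eta1_eta2_apply, vbkt_eta1_eta2]
  ext i
  fin_cases i <;> simp [eta2]
  norm_num

/-- at every `a ∈ ℝ⁵` the five vectors `η₁(a), η₂(a), [η₁,η₂](a),
[η₁,[η₁,η₂]](a), [η₂,[η₁,η₂]](a)` form a basis of `ℝ⁵`; in particular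
`D = ⟨η₁, η₂⟩` has growth `(2,3,5)` at every point. -/
theorem statement10 (a : Fin 5 → ℝ) :
    LinearIndependent ℝ
      ![eta1 a, eta2 a, vbkt eta1 eta2 a, vbkt eta1 (vbkt eta1 eta2) a,
        vbkt eta2 (vbkt eta1 eta2) a] ∧
    Submodule.span ℝ
      (Set.range
        ![eta1 a, eta2 a, vbkt eta1 eta2 a, vbkt eta1 (vbkt eta1 eta2) a,
          vbkt eta2 (vbkt eta1 eta2) a]) = ⊤ := by
  have hli : LinearIndependent ℝ
      ![eta1 a, eta2 a, vbkt eta1 eta2 a, vbkt eta1 (vbkt eta1 eta2) a,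
        vbkt eta2 (vbkt eta1 eta2) a] := by
    rw [vbkt_eta1_vbkt_eta1_eta2, vbkt_eta2_vbkt_eta1_eta2, vbkt_eta1_eta2,
      Fintype.linearIndependent_iff]
    intro g hg
    have h (j : Fin 5) := congrFun hg j
    have h0 : g 0 = 0 := by simpa [Fin.sum_univ_succ, eta1, eta2] using h 0
    have h1 : g 1 = 0 := by simpa [Fin.sum_univ_succ, eta1, eta2] using h 2
    have h2 : g 2 = 0 := by simpa [Fin.sum_univ_succ, eta1, eta2, h0, h1] using h 1
    have h3 : g 3 = 0 := by simpa [Fin.sum_univ_succ, eta1, eta2, h0, h1, h2] using h 3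
    have h4 : g 4 = 0 := by simpa [Fin.sum_univ_succ, eta1, eta2, h0, h1, h2, h3] using h 4
    intro i
    fin_cases i <;> assumption
  exact ⟨hli, hli.span_eq_top_of_card_eq_finrank (by simp)⟩
end

section
/- Define Ψ : ℝ⁶ × (ℝ \ {0}) → ℝ⁵ × ℝ⁵ by Ψ((λ,x,y,z,u,v), μ) = ((x,y,z,u,v), μ·(λ², −λ, 1, λx + 2λ²y + λ³z, −λ³)). Then Ψ is an immersion: at every point of ℝ⁶ × (ℝ \ {0}) its Fréchet derivative is injective. (This is the map π_{X*}|_{L∖0} : L ∖ 0 → TX for the G₂ double fibration, where L = ker(Dπ_Y) is trivialized by ξ₂ and the fiber coordinate μ.) -/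
open scoped BigOperators

/-- The map `π_{X*}|_L : L → TX` of the G₂ double fibration in the trivialization of
`L = ker(Dπ_Y)` by `ξ₂` and the fiber coordinate `μ`:
`Ψ((λ,x,y,z,u,v), μ) = ((x,y,z,u,v), μ·(λ², −λ, 1, λx + 2λ²y + λ³z, −λ³))`. -/
noncomputable def Psi (q : (Fin 6 → ℝ) × ℝ) : (Fin 5 → ℝ) × (Fin 5 → ℝ) :=
  (![q.1 1, q.1 2, q.1 3, q.1 4, q.1 5],
   q.2 • ![(q.1 0) ^ 2, -(q.1 0), 1,
     q.1 0 * q.1 1 + 2 * (q.1 0) ^ 2 * q.1 2 + (q.1 0) ^ 3 * q.1 3, -(q.1 0) ^ 3])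

/-- A left inverse of `Psi` over the locus where the fiber coordinate does not vanish. -/
noncomputable def PsiLeftInv (w : (Fin 5 → ℝ) × (Fin 5 → ℝ)) : (Fin 6 → ℝ) × ℝ :=
  (![-(w.2 1 / w.2 2), w.1 0, w.1 1, w.1 2, w.1 3, w.1 4], w.2 2)

lemma PsiLeftInv_Psi (q : (Fin 6 → ℝ) × ℝ) (hq : q.2 ≠ 0) : PsiLeftInv (Psi q) = q := by
  refine Prod.ext (funext fun i => ?_) ?_
  · fin_cases i <;> simp [PsiLeftInv, Psi]
    field_simp
  · simp [PsiLeftInv, Psi]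

lemma differentiable_Psi : Differentiable ℝ Psi := by
  unfold Psi
  refine Differentiable.prodMk (differentiable_pi.2 fun i => ?_)
    (differentiable_snd.fun_smul (differentiable_pi.2 fun i => ?_)) <;>
  fin_cases i <;> simp <;> fun_prop

lemma differentiableAt_PsiLeftInv (w : (Fin 5 → ℝ) × (Fin 5 → ℝ)) (hw : w.2 2 ≠ 0) :
    DifferentiableAt ℝ PsiLeftInv w := by
  unfold PsiLeftInv
  refine DifferentiableAt.prodMk (differentiableAt_pi.2 fun i => ?_) (by fun_prop)
  fin_cases i <;> simp <;> fun_prop (disch := assumption)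

/-- `Ψ` is an immersion on `ℝ⁶ × (ℝ ∖ {0})`: at every point with `μ ≠ 0`
its Fréchet derivative is injective (the map `π_{X*}|_{L∖0}` is an immersion). -/
theorem statement13 (p : Fin 6 → ℝ) (μ : ℝ) (hμ : μ ≠ 0) :
    Function.Injective ⇑(fderiv ℝ Psi (p, μ)) := by
  have hG : DifferentiableAt ℝ PsiLeftInv (Psi (p, μ)) :=
    differentiableAt_PsiLeftInv _ (by simpa [Psi] using hμ)
  have hev : PsiLeftInv ∘ Psi =ᶠ[nhds (p, μ)] id := by
    filter_upwards [continuous_snd.continuousAt.eventually_ne hμ] with q hq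
    exact PsiLeftInv_Psi q hq
  have hcomp := fderiv_comp (p, μ) hG (differentiable_Psi (p, μ))
  rw [hev.fderiv_eq, fderiv_id] at hcomp
  exact Function.LeftInverse.injective fun v => (DFunLike.congr_fun hcomp v).symm
end

section
/- With π_Y the G₂ fibration map: for every q ∈ ℝ⁵, the fiber π_Y⁻¹({q}) is a nonempty affine line in ℝ⁶, i.e. there exist p₀ ∈ ℝ⁶ and a nonzero vector d ∈ ℝ⁶ such that π_Y⁻¹({q}) = {p₀ + t·d : t ∈ ℝ}. -/
open scoped BigOperators

/-- every fiber of `π_Y` is a nonempty affine line in `ℝ⁶`. -/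
theorem statement16 (q : Fin 5 → ℝ) :
    ∃ (p₀ d : Fin 6 → ℝ), d ≠ 0 ∧
      piY ⁻¹' {q} = Set.range (fun t : ℝ => p₀ + t • d) := by
  refine ⟨![q 0, q 1 - q 0 * q 2, q 2, 0, q 4 - q 0 * q 2 ^ 2,
      q 3 - q 0 * q 1 + q 0 ^ 2 * q 2],
    ![0, q 0 ^ 2, -q 0, 1, q 0 ^ 2 * q 2 + q 0 * q 1, -q 0 ^ 3], ?_, ?_⟩
  · intro h
    simpa using congrFun h 3
  · ext p
    constructor
    · rintro rfl
      refine ⟨p 3, ?_⟩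
      ext i
      fin_cases i <;> simp [piY] <;> ring
    · rintro ⟨t, rfl⟩
      ext i
      fin_cases i <;> simp [piY] <;> ring
end

section
/- Let F : ℝ⁵ × ℝ → ℝ⁵ be the G₂ cone field F((x,y,z,u,v), λ) = (λ², −λ, 1, λx + 2λ²y + λ³z, −λ³), and let ω be the 1-form on ℝ⁵ (coordinates (x,y,z,u,v)) given by ω = −2y dx + x dy + du + z dv. Then: (i) at every point a = (x,y,z,u,v) ∈ ℝ⁵, the linear span of {F(a,λ) : λ ∈ ℝ} is exactly the 4-dimensional hyperplane ker ω_a = {w ∈ ℝ⁵ : ⟨(−2y, x, 0, 1, z), w⟩ = 0}; and (ii) ω is a contact form on ℝ⁵, i.e. ω ∧ dω ∧ dω vanishes nowhere (indeed ω ∧ dω ∧ dω = 6 du∧dx∧dy∧dz∧dv). Thus the linear hull of the G₂ cone structure is a contact structure. -/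
open scoped BigOperators

/-- The G₂ cone field `F((x,y,z,u,v), λ) = (λ², −λ, 1, λx + 2λ²y + λ³z, −λ³)`,
with coordinates `(x,y,z,u,v) = (a 0, …, a 4)` on `ℝ⁵`. -/
noncomputable def Fcone (q : (Fin 5 → ℝ) × ℝ) : Fin 5 → ℝ :=
  ![q.2 ^ 2, -q.2, 1, q.2 * q.1 0 + 2 * q.2 ^ 2 * q.1 1 + q.2 ^ 3 * q.1 2, -q.2 ^ 3]

/-- The coefficient covector of the 1-form `ω = −2y dx + x dy + du + z dv` on `ℝ⁵`
with coordinates `(x,y,z,u,v) = (a 0, …, a 4)`: `ω_a = (−2y, x, 0, 1, z)`. -/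
noncomputable def omegav (a : Fin 5 → ℝ) : Fin 5 → ℝ :=
  ![-2 * a 1, a 0, 0, 1, a 2]

/-- The exterior derivative `dω` of the 1-form `ω`, as a 2-form at `a`:
`dω_a(v,w) = (Dω(a)v)·w − (Dω(a)w)·v`. -/
noncomputable def domega (a v w : Fin 5 → ℝ) : ℝ :=
  (∑ j, fderiv ℝ omegav a v j * w j) - (∑ j, fderiv ℝ omegav a w j * v j)

/-- The 5-form `ω ∧ dω ∧ dω` at `a`, in the determinant convention
`(α∧β∧γ)(v₁,…,v₅) = (1/(1!·2!·2!)) ∑_{σ∈S₅} sgn(σ) α(v_{σ(0)}) β(v_{σ(1)},v_{σ(2)}) γ(v_{σ(3)},v_{σ(4)})`. -/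
noncomputable def omegaWedge (a : Fin 5 → ℝ) (v : Fin 5 → Fin 5 → ℝ) : ℝ :=
  (1 / 4 : ℝ) * ∑ σ : Equiv.Perm (Fin 5), ((Equiv.Perm.sign σ : ℤ) : ℝ) *
    ((∑ i, omegav a i * v (σ 0) i) *
      (domega a (v (σ 1)) (v (σ 2)) * domega a (v (σ 3)) (v (σ 4))))

/-- The functional `w ↦ ω_a(w)`. -/
noncomputable def omegaFunctional (a : Fin 5 → ℝ) : Module.Dual ℝ (Fin 5 → ℝ) :=
  ∑ i, omegav a i • LinearMap.proj i

theorem omegaFunctional_apply (a w : Fin 5 → ℝ) :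
    omegaFunctional a w = ∑ i, omegav a i * w i := by
  simp [omegaFunctional]

theorem omegaFunctional_ne_zero (a : Fin 5 → ℝ) : omegaFunctional a ≠ 0 := by
  intro h
  have h' := LinearMap.congr_fun h (Pi.single 3 1)
  simp [omegaFunctional_apply, Fin.sum_univ_five, omegav] at h'

theorem span_Fcone_eq_ker (a : Fin 5 → ℝ) :
    Submodule.span ℝ (Set.range fun lam : ℝ => Fcone (a, lam)) =
      LinearMap.ker (omegaFunctional a) := by
  apply le_antisymm
  · rw [Submodule.span_le]
    rintro _ ⟨l, rfl⟩
    simp only [SetLike.mem_coe, LinearMap.mem_ker, omegaFunctional_apply, Fin.sum_univ_five,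
      omegav, Fcone, Matrix.cons_val]
    ring
  · intro w hw
    simp only [LinearMap.mem_ker, omegaFunctional_apply, Fin.sum_univ_five, omegav,
      Matrix.cons_val] at hw
    have hF (l : ℝ) : Fcone (a, l) ∈ Submodule.span ℝ (Set.range fun lam : ℝ => Fcone (a, lam)) :=
      Submodule.subset_span ⟨l, rfl⟩
    have hw' : w = ((-w 4 - 2 * w 0 + w 1 + 2 * w 2) / 2) • Fcone (a, 0)
        + (-(-w 4 - w 0 + 2 * w 1) / 2) • Fcone (a, 1)
        + (-(-w 4 - 3 * w 0 - 2 * w 1) / 6) • Fcone (a, -1)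
        + ((-w 4 + w 1) / 6) • Fcone (a, 2) := by
      ext i
      fin_cases i <;> simp [Fcone] <;> first | ring1 | linear_combination hw
    rw [hw']
    exact add_mem (add_mem (add_mem (Submodule.smul_mem _ _ (hF _)) (Submodule.smul_mem _ _ (hF _)))
      (Submodule.smul_mem _ _ (hF _))) (Submodule.smul_mem _ _ (hF _))

theorem fderiv_omegav (a v : Fin 5 → ℝ) :
    fderiv ℝ omegav a v = ![-2 * v 1, v 0, 0, 0, v 2] := by
  have hc (i : Fin 5) : HasFDerivAt (fun b : Fin 5 → ℝ => b i)
      (ContinuousLinearMap.proj (R := ℝ) (φ := fun _ : Fin 5 => ℝ) i) a := hasFDerivAt_apply i a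
  have h : HasFDerivAt omegav (ContinuousLinearMap.pi
      ![(-2 : ℝ) • ContinuousLinearMap.proj (R := ℝ) (φ := fun _ : Fin 5 => ℝ) 1,
        ContinuousLinearMap.proj 0, 0, 0, ContinuousLinearMap.proj 2]) a := by
    rw [hasFDerivAt_pi]
    intro i
    fin_cases i
    · exact (hc 1).const_mul (-2)
    · exact hc 0
    · exact hasFDerivAt_const _ _
    · exact hasFDerivAt_const _ _
    · exact hc 2
  rw [h.fderiv]
  ext i
  fin_cases i <;> simp

theorem domega_eq (a v w : Fin 5 → ℝ) :
    domega a v w = 3 * (v 0 * w 1 - v 1 * w 0) + (v 2 * w 4 - v 4 * w 2) := by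
  simp only [domega, fderiv_omegav, Fin.sum_univ_five, Matrix.cons_val]
  ring

/-- The determinant of the components of `v₁,…,v₅` with indices `f 0,…,f 4`. -/
noncomputable def componentDet (v : Fin 5 → Fin 5 → ℝ) (f : Fin 5 → Fin 5) : ℝ :=
  Matrix.det (Matrix.of fun i j : Fin 5 => v i (f j))

theorem componentDet_eq_sum (v : Fin 5 → Fin 5 → ℝ) (f : Fin 5 → Fin 5) :
    componentDet v f = ∑ σ : Equiv.Perm (Fin 5), ((Equiv.Perm.sign σ : ℤ) : ℝ) *
      (v (σ 0) (f 0) * v (σ 1) (f 1) * v (σ 2) (f 2) * v (σ 3) (f 3) * v (σ 4) (f 4)) := by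
  simp [componentDet, Matrix.det_apply', Fin.prod_univ_five]

theorem componentDet_comp_perm (v : Fin 5 → Fin 5 → ℝ) (f : Fin 5 → Fin 5)
    (τ : Equiv.Perm (Fin 5)) :
    componentDet v (f ∘ τ) = ((Equiv.Perm.sign τ : ℤ) : ℝ) * componentDet v f :=
  Matrix.det_permute' τ (Matrix.of fun i j : Fin 5 => v i (f j))

theorem componentDet_of_eq (v : Fin 5 → Fin 5 → ℝ) (f : Fin 5 → Fin 5) (i j : Fin 5)
    (hij : i ≠ j) (h : f i = f j) : componentDet v f = 0 :=
  Matrix.det_zero_of_column_eq hij fun k => by simp [h]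

theorem componentDet_of_not_injective (v : Fin 5 → Fin 5 → ℝ) (f : Fin 5 → Fin 5)
    (h : ¬ Function.Injective f) : componentDet v f = 0 := by
  simp only [Function.Injective, not_forall] at h
  obtain ⟨i, j, hf, hij⟩ := h
  exact componentDet_of_eq v f i j hij hf

/-- The coefficients of `dω`, so that `dω(v,w) = ∑ j k, c j k * (v j * w k)`. -/
def domegaCoeff : Fin 5 → Fin 5 → ℝ :=
  ![![0, 3, 0, 0, 0], ![-3, 0, 0, 0, 0], ![0, 0, 0, 0, 1], ![0, 0, 0, 0, 0], ![0, 0, -1, 0, 0]]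

theorem domega_eq_sum (a v w : Fin 5 → ℝ) :
    domega a v w = ∑ j, ∑ k, domegaCoeff j k * (v j * w k) := by
  simp only [domega_eq, domegaCoeff, Fin.sum_univ_five, Matrix.cons_val]
  ring

theorem omegaWedge_eq_sum_componentDet (a : Fin 5 → ℝ) (v : Fin 5 → Fin 5 → ℝ) :
    omegaWedge a v = (1 / 4 : ℝ) * ∑ i, ∑ j, ∑ l, ∑ k, ∑ m,
      omegav a i * domegaCoeff j k * domegaCoeff l m * componentDet v ![i, j, k, l, m] := by
  simp only [omegaWedge, componentDet_eq_sum, domega_eq_sum, Finset.sum_mul_sum]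
  congr 1
  simp only [Finset.mul_sum]
  rw [Finset.sum_comm]
  refine Finset.sum_congr rfl fun i _ => ?_
  rw [Finset.sum_comm]
  refine Finset.sum_congr rfl fun j _ => ?_
  rw [Finset.sum_comm]
  refine Finset.sum_congr rfl fun l _ => ?_
  rw [Finset.sum_comm]
  refine Finset.sum_congr rfl fun k _ => ?_
  rw [Finset.sum_comm]
  refine Finset.sum_congr rfl fun m _ => Finset.sum_congr rfl fun σ _ => ?_
  simp only [Matrix.cons_val]
  ring

theorem omegaWedge_eq_det (a : Fin 5 → ℝ) (v : Fin 5 → Fin 5 → ℝ) :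
    omegaWedge a v = 6 * componentDet v ![3, 0, 1, 2, 4] := by
  have hperm (f : Fin 5 → Fin 5) (τ : Equiv.Perm (Fin 5)) (hf : f = ![3, 0, 1, 2, 4] ∘ τ) :
      componentDet v f = ((Equiv.Perm.sign τ : ℤ) : ℝ) * componentDet v ![3, 0, 1, 2, 4] := by
    rw [hf, componentDet_comp_perm]
  have hzero := componentDet_of_not_injective v
  have h₁ := hperm ![3, 1, 0, 2, 4] (Equiv.swap 1 2) (by decide)
  have h₂ := hperm ![3, 0, 1, 4, 2] (Equiv.swap 3 4) (by decide)
  have h₃ := hperm ![3, 1, 0, 4, 2] (Equiv.swap 1 2 * Equiv.swap 3 4) (by decide)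
  have h₄ := hperm ![3, 2, 4, 0, 1] (Equiv.swap 1 3 * Equiv.swap 2 4) (by decide)
  have h₅ := hperm ![3, 4, 2, 0, 1] (Equiv.swap 1 3 * Equiv.swap 2 4 * Equiv.swap 1 2) (by decide)
  have h₆ := hperm ![3, 2, 4, 1, 0] (Equiv.swap 1 3 * Equiv.swap 2 4 * Equiv.swap 3 4) (by decide)
  have h₇ := hperm ![3, 4, 2, 1, 0]
    (Equiv.swap 1 3 * Equiv.swap 2 4 * (Equiv.swap 1 2 * Equiv.swap 3 4)) (by decide)
  have hne : (1 : Fin 5) ≠ 2 ∧ (3 : Fin 5) ≠ 4 ∧ (1 : Fin 5) ≠ 3 ∧ (2 : Fin 5) ≠ 4 := by decide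
  simp only [Equiv.Perm.sign_mul, Equiv.Perm.sign_swap hne.1, Equiv.Perm.sign_swap hne.2.1,
    Equiv.Perm.sign_swap hne.2.2.1, Equiv.Perm.sign_swap hne.2.2.2] at h₁ h₂ h₃ h₄ h₅ h₆ h₇
  rw [omegaWedge_eq_sum_componentDet]
  simp only [Fin.sum_univ_five, domegaCoeff, omegav, Matrix.cons_val, mul_zero, zero_mul,
    add_zero, zero_add]
  simp (discharger := decide) only [hzero, h₁, h₂, h₃, h₄, h₅, h₆, h₇, mul_zero, add_zero, zero_add]
  push_cast
  ring

/-- (i) at every `a ∈ ℝ⁵` the linear span of the G₂ cone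
`{F(a,λ) : λ ∈ ℝ}` is exactly the 4-dimensional hyperplane `ker ω_a`;
(ii) `ω` is a contact form: `ω ∧ dω ∧ dω = 6 du∧dx∧dy∧dz∧dv` (in the determinant
convention, where `du∧dx∧dy∧dz∧dv (v₁,…,v₅)` is the determinant of the matrix of the
`(u,x,y,z,v)`-components of `v₁,…,v₅`), which vanishes nowhere. -/
theorem statement19 (a : Fin 5 → ℝ) :
    ((Submodule.span ℝ (Set.range fun lam : ℝ => Fcone (a, lam)) :
        Submodule ℝ (Fin 5 → ℝ)) : Set (Fin 5 → ℝ)) =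
      {w : Fin 5 → ℝ | ∑ i, omegav a i * w i = 0} ∧
    Module.finrank ℝ
      (Submodule.span ℝ (Set.range fun lam : ℝ => Fcone (a, lam))) = 4 ∧
    omegaWedge a =
      (fun v : Fin 5 → Fin 5 → ℝ =>
        6 * Matrix.det (Matrix.of fun i j : Fin 5 => v j ((![3, 0, 1, 2, 4] : Fin 5 → Fin 5) i))) ∧
    omegaWedge a ≠ 0 := by
  have hspan := span_Fcone_eq_ker a
  have hwedge : omegaWedge a = fun v : Fin 5 → Fin 5 → ℝ =>
      6 * Matrix.det (Matrix.of fun i j : Fin 5 =>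
        v j ((![3, 0, 1, 2, 4] : Fin 5 → Fin 5) i)) := by
    funext v
    rw [omegaWedge_eq_det, componentDet, ← Matrix.det_transpose]
    rfl
  refine ⟨?_, ?_, hwedge, ?_⟩
  · rw [hspan]
    ext w
    simp [omegaFunctional_apply]
  · rw [hspan]
    have h := Module.Dual.finrank_ker_add_one_of_ne_zero (omegaFunctional_ne_zero a)
    rw [Module.finrank_fin_fun] at h
    omega
  · intro h0
    have h := congrFun h0 fun j => Pi.single ((![3, 0, 1, 2, 4] : Fin 5 → Fin 5) j) 1
    have hone : (Matrix.of fun i j : Fin 5 =>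
        (Pi.single ((![3, 0, 1, 2, 4] : Fin 5 → Fin 5) j) 1 : Fin 5 → ℝ)
          ((![3, 0, 1, 2, 4] : Fin 5 → Fin 5) i)) = 1 := by
      ext i j
      fin_cases i <;> fin_cases j <;> simp
    rw [hwedge] at h
    simp only [hone, Matrix.det_one, Pi.zero_apply] at h
    norm_num at h
end
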